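/- There exist universal constants c1 and c such that the following holds: for any H >= 2, A >= 2, 0 < eps < 1/(48 sqrt(8)), and S >= c1, and for any learning algorithm that collects n episodes (by any exploration strategy) and outputs a policy pihat, if n <= c H^3 S A / eps^2, then there exists a time-inhomogeneous H-horizon MDP with S states, A actions, and rewards bounded in [0,1], on which the algorithm's output satisfies v* - v^{pihat} >= eps with probability at least 1/12, where v* = max_pi v^pi is the optimal value. -/

import Mathlib

open MeasureTheory Finset

noncomputable section

namespace OPE

/-- A finite, time-inhomogeneous episodic MDP (time indexed by `ℕ`; only times `< H` are used).
`P t s a s'` is the probability of transitioning from `(s, a)` at time `t` to state `s'` at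
time `t+1`, `r t s a` is the mean reward, and `d₁` the initial state distribution. -/
structure MDP (S A : Type) [Fintype S] [Fintype A] where
  P : ℕ → S → A → S → ℝ
  P_nonneg : ∀ t s a s', 0 ≤ P t s a s'
  P_sum : ∀ t s a, ∑ s', P t s a s' = 1
  r : ℕ → S → A → ℝ
  r_nonneg : ∀ t s a, 0 ≤ r t s a
  r_le_one : ∀ t s a, r t s a ≤ 1
  d₁ : S → ℝ
  d₁_nonneg : ∀ s, 0 ≤ d₁ s
  d₁_sum : ∑ s, d₁ s = 1

variable {S A : Type} [Fintype S] [Fintype A] [DecidableEq S] [DecidableEq A]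
  [Inhabited S] [Inhabited A]

/-- A (possibly stochastic, non-stationary) policy. -/
def IsPolicy (π : ℕ → S → A → ℝ) : Prop :=
  (∀ t s a, 0 ≤ π t s a) ∧ ∀ t s, ∑ a, π t s a = 1

/-- The stochastic policy associated with a deterministic policy. -/
def detToPolicy (g : ℕ → S → A) : ℕ → S → A → ℝ := fun t s a => if a = g t s then 1 else 0

/-- Marginal state-action distribution at time `t` under transitions `P`, initial state
distribution `d₁` and policy `π`. -/
def margDist (P : ℕ → S → A → S → ℝ) (d₁ : S → ℝ) (π : ℕ → S → A → ℝ) : ℕ → S × A → ℝ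
  | 0 => fun q => d₁ q.1 * π 0 q.1 q.2
  | t + 1 => fun q => π (t + 1) q.1 q.2 * ∑ p : S × A, P t p.1 p.2 q.1 * margDist P d₁ π t p

/-- Value iteration with `k` steps to go, starting at time `t`. -/
def Vaux (P : ℕ → S → A → S → ℝ) (r : ℕ → S → A → ℝ) (π : ℕ → S → A → ℝ) : ℕ → ℕ → S → ℝ
  | 0, _, _ => 0
  | k + 1, t, s => ∑ a, π t s a * (r t s a + ∑ s', P t s a s' * Vaux P r π k (t + 1) s')

/-- Value function `V_t^π` of policy `π` in the `H`-horizon MDP with transitions `P`,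
mean rewards `r`. -/
def Vf (P : ℕ → S → A → S → ℝ) (r : ℕ → S → A → ℝ) (π : ℕ → S → A → ℝ) (H t : ℕ) :
    S → ℝ := Vaux P r π (H - t) t

/-- Q-function `Q_t^π`. -/
def Qf (P : ℕ → S → A → S → ℝ) (r : ℕ → S → A → ℝ) (π : ℕ → S → A → ℝ) (H t : ℕ) :
    S → A → ℝ := fun s a => r t s a + ∑ s', P t s a s' * Vf P r π H (t + 1) s'

/-- The value `v^π = E_π[∑_{t<H} r_t]` of policy `π`. -/
def polValue (P : ℕ → S → A → S → ℝ) (r : ℕ → S → A → ℝ) (d₁ : S → ℝ)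
    (π : ℕ → S → A → ℝ) (H : ℕ) : ℝ :=
  ∑ t ∈ Finset.range H, ∑ q : S × A, margDist P d₁ π t q * r t q.1 q.2

/-- Optimal value iteration. -/
def VstarAux (M : MDP S A) : ℕ → ℕ → S → ℝ
  | 0, _, _ => 0
  | k + 1, t, s => ⨆ a : A, (M.r t s a + ∑ s', M.P t s a s' * VstarAux M k (t + 1) s')

/-- The optimal value `v* = max_π v^π`. -/
def vStar (M : MDP S A) (H : ℕ) : ℝ := ∑ s, M.d₁ s * VstarAux M H 0 s

/-- An episode: the state-action pairs and (random, real-valued) rewards at times `0, …, H-1`. -/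
abbrev Episode (S A : Type) (H : ℕ) : Type := (Fin H → S × A) × (Fin H → ℝ)

/-- A dataset of `n` episodes. -/
abbrev Dataset (S A : Type) (H n : ℕ) : Type := Fin n → Episode S A H

/-- Safe access to the `t`-th entry of a path. -/
def pget {H : ℕ} (p : Fin H → S × A) (t : ℕ) : S × A := if h : t < H then p ⟨t, h⟩ else default

/-- State-action pair of episode `e` at time `t`. -/
def esa {H : ℕ} (e : Episode S A H) (t : ℕ) : S × A := pget e.1 t

/-- Reward of episode `e` at time `t`. -/
def erew {H : ℕ} (e : Episode S A H) (t : ℕ) : ℝ := if h : t < H then e.2 ⟨t, h⟩ else 0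

/-- Visitation count `n_{s,a}` at time `t`. -/
def cnt {H n : ℕ} (D : Dataset S A H n) (t : ℕ) (q : S × A) : ℕ :=
  (univ.filter fun i => esa (D i) t = q).card

/-- Count of transitions from `q` at time `t` to state `s'` at time `t+1`. -/
def cnt2 {H n : ℕ} (D : Dataset S A H n) (t : ℕ) (s' : S) (q : S × A) : ℕ :=
  (univ.filter fun i => esa (D i) t = q ∧ (esa (D i) (t + 1)).1 = s').card

/-- Empirical transition kernel `P̂`. -/
def Phat {H n : ℕ} (D : Dataset S A H n) : ℕ → S → A → S → ℝ := fun t s a s' =>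
  if cnt D t (s, a) = 0 then 0 else (cnt2 D t s' (s, a) : ℝ) / (cnt D t (s, a) : ℝ)

/-- Empirical mean reward `r̂`. -/
def rhat {H n : ℕ} (D : Dataset S A H n) : ℕ → S → A → ℝ := fun t s a =>
  if cnt D t (s, a) = 0 then 0
  else (∑ i, if esa (D i) t = (s, a) then erew (D i) t else 0) / (cnt D t (s, a) : ℝ)

/-- Empirical initial state distribution. -/
def d1hat {H n : ℕ} (D : Dataset S A H n) : S → ℝ := fun s =>
  ((univ.filter fun i => (esa (D i) 0).1 = s).card : ℝ) / (n : ℝ)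

/-- The OPEMA (model-based plug-in) estimator of `v^π`, built from the full dataset `D`. -/
def vhat {H n : ℕ} (D : Dataset S A H n) (π : ℕ → S → A → ℝ) : ℝ :=
  polValue (Phat D) (rhat D) (d1hat D) π H

/-- `N`: the minimum visitation count over all times `t < H` and all state-action pairs that are
accessible under the logging policy `μ`. -/
def Nmin {H n : ℕ} (M : MDP S A) (μ : ℕ → S → A → ℝ) (D : Dataset S A H n) : ℕ :=
  sInf {k | ∃ t < H, ∃ q : S × A, 0 < margDist M.P M.d₁ μ t q ∧ cnt D t q = k}

/-- Number of episodes before `i` visiting `q` at time `t` (used to select the first `N`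
transitions at each state-action pair). -/
def rankLt {H n : ℕ} (D : Dataset S A H n) (t : ℕ) (q : S × A) (i : Fin n) : ℕ :=
  (univ.filter fun j => j < i ∧ esa (D j) t = q).card

/-- Transition counts using only the first `N` visits to each state-action pair
(the sub-dataset `D'`). -/
def cnt2' {H n : ℕ} (D : Dataset S A H n) (N t : ℕ) (s' : S) (q : S × A) : ℕ :=
  (univ.filter fun i => esa (D i) t = q ∧ (esa (D i) (t + 1)).1 = s' ∧ rankLt D t q i < N).card

/-- Empirical transition kernel built from the sub-dataset `D'`. -/
def Phat' {H n : ℕ} (D : Dataset S A H n) (N : ℕ) : ℕ → S → A → S → ℝ := fun t s a s' =>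
  if N = 0 then 0 else (cnt2' D N t s' (s, a) : ℝ) / (N : ℝ)

/-- Empirical mean reward built from the sub-dataset `D'`. -/
def rhat' {H n : ℕ} (D : Dataset S A H n) (N : ℕ) : ℕ → S → A → ℝ := fun t s a =>
  if N = 0 then 0
  else (∑ i, if esa (D i) t = (s, a) ∧ rankLt D t (s, a) i < N then erew (D i) t else 0) / (N : ℝ)

/-- The OPEMA estimator built from the sub-dataset `D'`. -/
def vhat' {H n : ℕ} (M : MDP S A) (μ : ℕ → S → A → ℝ) (D : Dataset S A H n)
    (π : ℕ → S → A → ℝ) : ℝ :=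
  polValue (Phat' D (Nmin M μ D)) (rhat' D (Nmin M μ D)) (d1hat D) π H

/-- Fictitious transition kernel `P̃` (full dataset): equals `P̂` on the event
`E_t(s,a) = {n_{s,a} ≥ n d_t^μ(s,a)/2}` and the true `P` otherwise. -/
def Ptil {H n : ℕ} (M : MDP S A) (μ : ℕ → S → A → ℝ) (D : Dataset S A H n) :
    ℕ → S → A → S → ℝ := fun t s a s' =>
  if (n : ℝ) * margDist M.P M.d₁ μ t (s, a) / 2 ≤ (cnt D t (s, a) : ℝ) then Phat D t s a s'
  else M.P t s a s'

/-- Fictitious mean reward `r̃` (full dataset). -/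
def rtil {H n : ℕ} (M : MDP S A) (μ : ℕ → S → A → ℝ) (D : Dataset S A H n) :
    ℕ → S → A → ℝ := fun t s a =>
  if (n : ℝ) * margDist M.P M.d₁ μ t (s, a) / 2 ≤ (cnt D t (s, a) : ℝ) then rhat D t s a
  else M.r t s a

/-- Fictitious marginal state-action distribution `d̃_t^π` (full dataset). -/
def dtil {H n : ℕ} (M : MDP S A) (μ : ℕ → S → A → ℝ) (D : Dataset S A H n)
    (π : ℕ → S → A → ℝ) : ℕ → S × A → ℝ :=
  margDist (Ptil M μ D) (d1hat D) π

/-- Fictitious transition kernel built from the sub-dataset `D'`: equals the `D'`-based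
empirical kernel on the event `E = {N ≥ n d_m/2}` and the true `P` otherwise. -/
def Ptil' {H n : ℕ} (M : MDP S A) (μ : ℕ → S → A → ℝ) (dm : ℝ) (D : Dataset S A H n) :
    ℕ → S → A → S → ℝ := fun t s a s' =>
  if (n : ℝ) * dm / 2 ≤ (Nmin M μ D : ℝ) then Phat' D (Nmin M μ D) t s a s' else M.P t s a s'

/-- Fictitious marginal state-action distribution built from the sub-dataset `D'`. -/
def dtil' {H n : ℕ} (M : MDP S A) (μ : ℕ → S → A → ℝ) (dm : ℝ) (D : Dataset S A H n)
    (π : ℕ → S → A → ℝ) : ℕ → S × A → ℝ :=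
  margDist (Ptil' M μ dm D) (d1hat D) π

/-- `dm` is a positive lower bound for all positive marginal state-action occupancies of the
logging policy `μ` (i.e. `dm ≤ d_m := min{d_t^μ(s,a) : d_t^μ(s,a) > 0}`). -/
def DmLB (M : MDP S A) (μ : ℕ → S → A → ℝ) (H : ℕ) (dm : ℝ) : Prop :=
  0 < dm ∧ ∀ t < H, ∀ q : S × A, 0 < margDist M.P M.d₁ μ t q → dm ≤ margDist M.P M.d₁ μ t q

/-- Assumption 2 (exploration requirement): the logging policy `μ` visits every accessible
state with positive probability. -/
def Explores (M : MDP S A) (μ : ℕ → S → A → ℝ) (H : ℕ) : Prop :=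
  ∀ t < H, ∀ s : S,
    (∃ π, IsPolicy π ∧ 0 < ∑ a, margDist M.P M.d₁ π t (s, a)) →
    0 < ∑ a, margDist M.P M.d₁ μ t (s, a)

section Law

variable [MeasurableSpace S] [MeasurableSpace A]

/-- Probability of a state-action path under the logging policy `μ`. -/
def pathWeight (M : MDP S A) (μ : ℕ → S → A → ℝ) {H : ℕ} (p : Fin H → S × A) : ℝ :=
  (M.d₁ (pget p 0).1 * μ 0 (pget p 0).1 (pget p 0).2) *
    ∏ t ∈ Finset.range (H - 1),
      (M.P t (pget p t).1 (pget p t).2 (pget p (t + 1)).1 *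
        μ (t + 1) (pget p (t + 1)).1 (pget p (t + 1)).2)

/-- The law of a single episode generated by the logging policy `μ` in the MDP `M`, with reward
distributions `R t s a` (supported on `[0,1]` with mean `M.r t s a`). -/
def episodeLaw (M : MDP S A) (μ : ℕ → S → A → ℝ) (R : ℕ → S → A → Measure ℝ) (H : ℕ) :
    Measure (Episode S A H) :=
  ∑ p : Fin H → S × A,
    ENNReal.ofReal (pathWeight M μ p) •
      ((Measure.dirac p).prod (Measure.pi fun t : Fin H => R (t : ℕ) (p t).1 (p t).2))

/-- The law of a dataset of `n` i.i.d. episodes generated by `μ` in `M`. -/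
def datasetLaw (M : MDP S A) (μ : ℕ → S → A → ℝ) (R : ℕ → S → A → Measure ℝ) (H n : ℕ) :
    Measure (Dataset S A H n) :=
  Measure.pi fun _ : Fin n => episodeLaw M μ R H

/-- The reward distributions `R` are probability measures supported on `[0,1]` whose means are
the mean rewards of `M`. -/
def ValidReward (M : MDP S A) (R : ℕ → S → A → Measure ℝ) : Prop :=
  ∀ t s a, IsProbabilityMeasure (R t s a) ∧ (R t s a) (Set.Icc (0 : ℝ) 1)ᶜ = 0 ∧
    (∫ x, x ∂(R t s a)) = M.r t s a

end Law

end OPE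
namespace OPE

variable {S A : Type} [Fintype S] [Fintype A] [DecidableEq S] [DecidableEq A]
  [Inhabited S] [Inhabited A]

/-- The law of the `k` episodes collected by an adaptive learning algorithm whose exploration
strategy `behav` chooses the behavior policy for episode `k` as a function of the first `k`
episodes. -/
def algLaw [MeasurableSpace S] [MeasurableSpace A]
    (M : MDP S A) (R : ℕ → S → A → Measure ℝ) (H : ℕ)
    (behav : (k : ℕ) → (Fin k → Episode S A H) → (ℕ → S → A → ℝ)) :
    (k : ℕ) → Measure (Fin k → Episode S A H)
  | 0 => Measure.dirac (fun i => i.elim0)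
  | k + 1 =>
      (algLaw M R H behav k).bind
        (fun Dk => Measure.map (Fin.snoc Dk) (episodeLaw M (behav k Dk) R H))

set_option linter.unusedSectionVars false

lemma sum_fin_succ_eq_sum_snoc {X : Type*} [Fintype X] (k : ℕ) (f : (Fin (k + 1) → X) → ℝ) :
    ∑ ω, f ω = ∑ ω : Fin k → X, ∑ x, f (Fin.snoc ω x) := by
  rw [← (Fin.snocEquiv (fun _ : Fin (k + 1) => X)).sum_comp, Fintype.sum_prod_type_right]
  rfl

section Chain

variable {X : Type*}

/-- The weight of a path of a Markov chain with initial weights `ν` and kernels `K`. -/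
def chainWeight (ν : X → ℝ) (K : ℕ → X → X → ℝ) (m : ℕ) (p : Fin (m + 1) → X) : ℝ :=
  ν (p 0) * ∏ t : Fin m, K t (p t.castSucc) (p t.succ)

variable [Fintype X]

/-- The time-`t` marginal of a Markov chain. -/
def chainMarginal (ν : X → ℝ) (K : ℕ → X → X → ℝ) : ℕ → X → ℝ
  | 0 => ν
  | t + 1 => fun y => ∑ x, chainMarginal ν K t x * K t x y

lemma chainWeight_snoc (ν : X → ℝ) (K : ℕ → X → X → ℝ) (m : ℕ) (p : Fin (m + 1) → X) (x : X) :
    chainWeight ν K (m + 1) (Fin.snoc p x : Fin (m + 2) → X) =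
      chainWeight ν K m p * K m (p (Fin.last m)) x := by
  have h0 : (Fin.snoc p x : Fin (m + 2) → X) 0 = p 0 := by
    rw [← Fin.castSucc_zero, Fin.snoc_castSucc (α := fun _ => X)]
  have hs : ∀ t : Fin m, (Fin.snoc p x : Fin (m + 2) → X) t.castSucc.succ = p t.succ := by
    intro t
    rw [← Fin.castSucc_succ, Fin.snoc_castSucc (α := fun _ => X)]
  unfold chainWeight
  rw [Fin.prod_univ_castSucc, h0, mul_assoc]
  simp only [Fin.snoc_castSucc (α := fun _ => X), hs, Fin.succ_last,
    Fin.snoc_last (α := fun _ => X), Fin.val_castSucc, Fin.val_last]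

lemma sum_chainWeight_mul_last (ν : X → ℝ) (K : ℕ → X → X → ℝ) (m : ℕ) (G : X → ℝ) :
    ∑ p, chainWeight ν K m p * G (p (Fin.last m)) = ∑ x, chainMarginal ν K m x * G x := by
  induction m generalizing G with
  | zero =>
    rw [← (Equiv.funUnique (Fin 1) X).symm.sum_comp]
    simp [chainWeight, chainMarginal, Equiv.funUnique]
  | succ m ih =>
    rw [sum_fin_succ_eq_sum_snoc]
    simp only [chainWeight_snoc, Fin.snoc_last (α := fun _ => X), mul_assoc, ← mul_sum]
    rw [ih (fun z => ∑ x, K m z x * G x)]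
    simp only [chainMarginal, mul_sum, sum_mul]
    rw [sum_comm]
    simp only [mul_assoc]

lemma sum_chainWeight_mul_step (ν : X → ℝ) (K : ℕ → X → X → ℝ)
    (hK : ∀ t x, ∑ y, K t x y = 1) (F : X → X → ℝ) (m : ℕ) (t : Fin m) :
    ∑ p, chainWeight ν K m p * F (p t.castSucc) (p t.succ) =
      ∑ x, chainMarginal ν K t x * ∑ y, K t x y * F x y := by
  induction m with
  | zero => exact t.elim0
  | succ m ih =>
    rw [sum_fin_succ_eq_sum_snoc]
    induction t using Fin.lastCases with
    | last =>
      simp only [chainWeight_snoc, Fin.succ_last, Fin.snoc_castSucc (α := fun _ => X),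
        Fin.snoc_last (α := fun _ => X), mul_assoc, ← mul_sum]
      exact sum_chainWeight_mul_last ν K m (fun z => ∑ x, K m z x * F z x)
    | cast t =>
      rw [Fin.val_castSucc, ← ih t]
      refine sum_congr rfl fun p _ => ?_
      simp only [chainWeight_snoc, ← Fin.castSucc_succ, Fin.snoc_castSucc (α := fun _ => X)]
      rw [← sum_mul, ← mul_sum, hK, mul_one]

end Chain

lemma margDist_eq_chainMarginal (M : MDP S A) (μ : ℕ → S → A → ℝ) (t : ℕ) :
    margDist M.P M.d₁ μ t = chainMarginal (fun q => M.d₁ q.1 * μ 0 q.1 q.2)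
      (fun t p q => M.P t p.1 p.2 q.1 * μ (t + 1) q.1 q.2) t := by
  induction t with
  | zero => rfl
  | succ t ih =>
    funext q
    simp only [margDist, chainMarginal, ← ih, mul_sum]
    exact sum_congr rfl fun p _ => by ring

lemma sum_policy_mul {μ : ℕ → S → A → ℝ} (hμ : IsPolicy μ) (t : ℕ) (f : S → ℝ) :
    ∑ q : S × A, f q.1 * μ t q.1 q.2 = ∑ s, f s := by
  rw [Fintype.sum_prod_type]
  exact sum_congr rfl fun s _ => by simp only [← mul_sum, hμ.2, mul_one]

lemma pathWeight_eq_chainWeight (M : MDP S A) (μ : ℕ → S → A → ℝ) (m : ℕ)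
    (p : Fin (m + 1) → S × A) :
    pathWeight M μ p = chainWeight (fun q => M.d₁ q.1 * μ 0 q.1 q.2)
      (fun t p q => M.P t p.1 p.2 q.1 * μ (t + 1) q.1 q.2) m p := by
  unfold pathWeight chainWeight
  rw [Nat.add_sub_cancel, Finset.prod_range]
  congr 1
  refine prod_congr rfl fun t _ => ?_
  have h1 : pget p (t : ℕ) = p t.castSucc := dif_pos (by omega)
  have h2 : pget p ((t : ℕ) + 1) = p t.succ := dif_pos (by omega)
  rw [h1, h2]

lemma pathWeight_nonneg (M : MDP S A) {μ : ℕ → S → A → ℝ} (hμ : IsPolicy μ) {H : ℕ}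
    (p : Fin H → S × A) : 0 ≤ pathWeight M μ p :=
  mul_nonneg (mul_nonneg (M.d₁_nonneg _) (hμ.1 _ _ _))
    (prod_nonneg fun _ _ => mul_nonneg (M.P_nonneg _ _ _ _) (hμ.1 _ _ _))

lemma sum_pathWeight_mul_step (M : MDP S A) {μ : ℕ → S → A → ℝ} (hμ : IsPolicy μ) {H t : ℕ}
    (ht : t + 1 < H) (F : S × A → S → ℝ) :
    ∑ p : Fin H → S × A, pathWeight M μ p * F (pget p t) (pget p (t + 1)).1 =
      ∑ q, margDist M.P M.d₁ μ t q * ∑ s', M.P t q.1 q.2 s' * F q s' := by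
  obtain ⟨m, rfl⟩ : ∃ m, H = m + 1 := ⟨H - 1, by omega⟩
  have hK : ∀ t (x : S × A), ∑ y : S × A, M.P t x.1 x.2 y.1 * μ (t + 1) y.1 y.2 = 1 := by
    intro t x
    rw [sum_policy_mul hμ (t + 1) (M.P t x.1 x.2), M.P_sum]
  have h := sum_chainWeight_mul_step (fun q => M.d₁ q.1 * μ 0 q.1 q.2)
    (fun t p q => M.P t p.1 p.2 q.1 * μ (t + 1) q.1 q.2) hK
    (fun x y => F x y.1) m ⟨t, by omega⟩
  rw [margDist_eq_chainMarginal]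
  have hl : ∀ p : Fin (m + 1) → S × A, pathWeight M μ p * F (pget p t) (pget p (t + 1)).1 =
      chainWeight (fun q => M.d₁ q.1 * μ 0 q.1 q.2)
        (fun t p q => M.P t p.1 p.2 q.1 * μ (t + 1) q.1 q.2) m p *
        F (p (Fin.castSucc ⟨t, by omega⟩)) (p (Fin.succ ⟨t, by omega⟩)).1 := by
    intro p
    have h1 : pget p t = p (Fin.castSucc ⟨t, by omega⟩) := dif_pos (by omega)
    have h2 : pget p (t + 1) = p (Fin.succ ⟨t, by omega⟩) := dif_pos (by omega)
    rw [pathWeight_eq_chainWeight, h1, h2]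
  rw [sum_congr rfl fun p _ => hl p, h]
  refine sum_congr rfl fun q _ => ?_
  congr 1
  rw [← sum_policy_mul hμ (t + 1) (fun s' => M.P t q.1 q.2 s' * F q s')]
  exact sum_congr rfl fun y _ => by ring

lemma sum_margDist (M : MDP S A) {μ : ℕ → S → A → ℝ} (hμ : IsPolicy μ) (t : ℕ) :
    ∑ q, margDist M.P M.d₁ μ t q = 1 := by
  induction t with
  | zero => exact (sum_policy_mul hμ 0 M.d₁).trans M.d₁_sum
  | succ t ih =>
    have h := sum_policy_mul hμ (t + 1)
      (fun s => ∑ p : S × A, M.P t p.1 p.2 s * margDist M.P M.d₁ μ t p)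
    simp only [margDist]
    rw [sum_congr rfl fun q _ => mul_comm _ _, h, sum_comm]
    simp only [← sum_mul, M.P_sum, one_mul, ih]

lemma sum_pathWeight (M : MDP S A) {μ : ℕ → S → A → ℝ} (hμ : IsPolicy μ) {H : ℕ} (hH : 2 ≤ H) :
    ∑ p : Fin H → S × A, pathWeight M μ p = 1 := by
  have h := sum_pathWeight_mul_step M hμ (t := 0) (H := H) (by omega) (fun _ _ => 1)
  simpa [M.P_sum, sum_margDist M hμ] using h

/-- The performance difference identity: the deficit of `π` against any candidate value function
`U` vanishing at the horizon is the expected sum of its Bellman gaps. -/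
lemma sum_d₁_mul_sub_polValue (M : MDP S A) {π : ℕ → S → A → ℝ} (hπ : IsPolicy π)
    (U : ℕ → S → ℝ) (H : ℕ) (hU : ∀ s, U H s = 0) :
    ∑ s, M.d₁ s * U 0 s - polValue M.P M.r M.d₁ π H =
      ∑ t ∈ range H, ∑ q : S × A, margDist M.P M.d₁ π t q *
        (U t q.1 - M.r t q.1 q.2 - ∑ s', M.P t q.1 q.2 s' * U (t + 1) s') := by
  have hstep : ∀ t, ∑ q : S × A, margDist M.P M.d₁ π t q *
      ∑ s', M.P t q.1 q.2 s' * U (t + 1) s' =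
      ∑ q : S × A, margDist M.P M.d₁ π (t + 1) q * U (t + 1) q.1 := by
    intro t
    have h := sum_policy_mul hπ (t + 1)
      (fun s => (∑ p : S × A, M.P t p.1 p.2 s * margDist M.P M.d₁ π t p) * U (t + 1) s)
    simp only [margDist]
    rw [sum_congr rfl fun (q : S × A) _ => show
      (π (t + 1) q.1 q.2 * ∑ p : S × A, M.P t p.1 p.2 q.1 * margDist M.P M.d₁ π t p) *
        U (t + 1) q.1 = ((∑ p : S × A, M.P t p.1 p.2 q.1 * margDist M.P M.d₁ π t p) *
        U (t + 1) q.1) * π (t + 1) q.1 q.2 by ring, h]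
    simp only [mul_sum, sum_mul]
    rw [sum_comm]
    exact sum_congr rfl fun _ _ => sum_congr rfl fun _ _ => by ring
  have h0 : ∑ s, M.d₁ s * U 0 s = ∑ q : S × A, margDist M.P M.d₁ π 0 q * U 0 q.1 := by
    rw [← sum_policy_mul hπ 0]
    exact sum_congr rfl fun q _ => by simp only [margDist]; ring
  have htel := Finset.sum_range_sub'
    (fun t => ∑ q : S × A, margDist M.P M.d₁ π t q * U t q.1) H
  simp only [hU, mul_zero, sum_const_zero, sub_zero] at htel
  rw [h0, ← htel, polValue, ← sum_sub_distrib]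
  refine sum_congr rfl fun t _ => ?_
  simp only [mul_sub, sum_sub_distrib, hstep t]
  ring

lemma le_vStar (M : MDP S A) (H : ℕ) (U : ℕ → S → ℝ) (hU : ∀ s, U H s = 0)
    (hB : ∀ t < H, ∀ s, ∃ a, U t s ≤ M.r t s a + ∑ s', M.P t s a s' * U (t + 1) s') :
    ∑ s, M.d₁ s * U 0 s ≤ vStar M H := by
  have key : ∀ k t, k + t = H → ∀ s, U t s ≤ VstarAux M k t s := by
    intro k
    induction k with
    | zero =>
      intro t ht s
      obtain rfl : t = H := by omega
      simp [hU, VstarAux]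
    | succ k ih =>
      intro t ht s
      obtain ⟨a, ha⟩ := hB t (by omega) s
      refine ha.trans ?_
      rw [VstarAux]
      refine le_trans ?_ (le_ciSup (Set.finite_range _).bddAbove a)
      gcongr with s' _
      · exact M.P_nonneg _ _ _ _
      · exact ih (t + 1) (by omega) s'
  exact sum_le_sum fun s _ => mul_le_mul_of_nonneg_left (key H 0 rfl s) (M.d₁_nonneg s)

section Adaptive

variable {X : Type*} [Fintype X]

/-- The weight of a sequence of outcomes drawn adaptively, the `k`-th one from `p k` given the
first `k` outcomes. -/
def seqWeight (p : (k : ℕ) → (Fin k → X) → X → ℝ) : (k : ℕ) → (Fin k → X) → ℝ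
  | 0, _ => 1
  | k + 1, ω => seqWeight p k (Fin.init ω) * p k (Fin.init ω) (ω (Fin.last k))

lemma seqWeight_snoc (p : (k : ℕ) → (Fin k → X) → X → ℝ) (k : ℕ) (ω : Fin k → X) (x : X) :
    seqWeight p (k + 1) (Fin.snoc ω x : Fin (k + 1) → X) = seqWeight p k ω * p k ω x := by
  simp only [seqWeight, Fin.init_snoc (α := fun _ => X), Fin.snoc_last (α := fun _ => X)]

lemma seqWeight_nonneg {p : (k : ℕ) → (Fin k → X) → X → ℝ} (hp : ∀ k ω x, 0 ≤ p k ω x)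
    (k : ℕ) (ω : Fin k → X) : 0 ≤ seqWeight p k ω := by
  induction k with
  | zero => exact zero_le_one
  | succ k ih => exact mul_nonneg (ih _) (hp _ _ _)

lemma sum_seqWeight {p : (k : ℕ) → (Fin k → X) → X → ℝ} (hp1 : ∀ k ω, ∑ x, p k ω x = 1)
    (k : ℕ) : ∑ ω, seqWeight p k ω = 1 := by
  induction k with
  | zero => simp [seqWeight]
  | succ k ih =>
    rw [sum_fin_succ_eq_sum_snoc]
    simp only [seqWeight_snoc, ← mul_sum, hp1, mul_one, ih]

lemma sum_seqWeight_mul_sum_le {p : (k : ℕ) → (Fin k → X) → X → ℝ}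
    (hp : ∀ k ω x, 0 ≤ p k ω x) (hp1 : ∀ k ω, ∑ x, p k ω x = 1) {ℓ : X → ℝ} {B : ℝ}
    (hB : ∀ k ω, ∑ x, p k ω x * ℓ x ≤ B) (n : ℕ) :
    ∑ ω, seqWeight p n ω * ∑ i, ℓ (ω i) ≤ n * B := by
  induction n with
  | zero => simp
  | succ n ih =>
    rw [sum_fin_succ_eq_sum_snoc]
    have h : ∀ ω : Fin n → X, ∑ x, seqWeight p (n + 1) (Fin.snoc ω x : Fin (n + 1) → X) *
        ∑ i, ℓ ((Fin.snoc ω x : Fin (n + 1) → X) i) =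
        seqWeight p n ω * ∑ i, ℓ (ω i) + seqWeight p n ω * ∑ x, p n ω x * ℓ x := by
      intro ω
      have h' : ∀ x, seqWeight p (n + 1) (Fin.snoc ω x : Fin (n + 1) → X) *
          ∑ i, ℓ ((Fin.snoc ω x : Fin (n + 1) → X) i) =
          p n ω x * (seqWeight p n ω * ∑ i, ℓ (ω i)) + seqWeight p n ω * (p n ω x * ℓ x) := by
        intro x
        rw [seqWeight_snoc, Fin.sum_univ_castSucc]
        simp only [Fin.snoc_castSucc (α := fun _ => X), Fin.snoc_last (α := fun _ => X)]
        ring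
      simp only [h', sum_add_distrib, ← sum_mul, hp1, one_mul, ← mul_sum]
    simp only [h, sum_add_distrib]
    have h2 : ∑ ω, seqWeight p n ω * ∑ x, p n ω x * ℓ x ≤ ∑ ω, seqWeight p n ω * B :=
      sum_le_sum fun ω _ => mul_le_mul_of_nonneg_left (hB n ω) (seqWeight_nonneg hp n ω)
    rw [← sum_mul, sum_seqWeight hp1, one_mul] at h2
    push_cast
    linarith

lemma seqWeight_tilt {p q : (k : ℕ) → (Fin k → X) → X → ℝ} {ℓ : X → ℝ}
    (h : ∀ k ω x, q k ω x = p k ω x * Real.exp (-ℓ x)) (n : ℕ) (ω : Fin n → X) :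
    seqWeight q n ω = seqWeight p n ω * Real.exp (-∑ i, ℓ (ω i)) := by
  induction n with
  | zero => simp [seqWeight]
  | succ n ih =>
    simp only [seqWeight, ih, h, Fin.sum_univ_castSucc, neg_add, Real.exp_add, Fin.init]
    ring

end Adaptive

/-- Change of measure for bounded functions, with the total variation distance controlled by the
relative entropy `∑ P Λ`. -/
lemma sum_mul_le_of_exp_tilt {Ω : Type*} [Fintype Ω] {P Q Λ f : Ω → ℝ} (hP : ∀ ω, 0 ≤ P ω)
    (hP1 : ∑ ω, P ω = 1) (hQ1 : ∑ ω, Q ω = 1) (hQ : ∀ ω, Q ω = P ω * Real.exp (-Λ ω))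
    (hf0 : ∀ ω, 0 ≤ f ω) (hf1 : ∀ ω, f ω ≤ 1) {c : ℝ} (hc : 0 < c) :
    ∑ ω, Q ω * f ω ≤ ∑ ω, P ω * f ω + c * ∑ ω, P ω * Λ ω + 1 / c := by
  have key : ∀ ω, Q ω * f ω ≤ P ω * f ω + c * (Q ω - P ω + P ω * Λ ω) +
      1 / (2 * c) * (Q ω + P ω) := by
    intro ω
    set x := Real.exp (-Λ ω / 2) with hx
    have hx0 : 0 < x := Real.exp_pos _
    have hx1 : 1 - Λ ω / 2 ≤ x := by
      have := Real.add_one_le_exp (-Λ ω / 2)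
      rw [← hx] at this
      linarith
    have hxx : Real.exp (-Λ ω) = x ^ 2 := by
      rw [hx, ← Real.exp_nat_mul]
      congr 1
      push_cast
      ring
    have h1 : (x ^ 2 - 1) * f ω ≤ c * (x - 1) ^ 2 + 1 / (4 * c) * (x + 1) ^ 2 := by
      have ha : (x ^ 2 - 1) * f ω ≤ |x ^ 2 - 1| := by
        calc (x ^ 2 - 1) * f ω ≤ |x ^ 2 - 1| * f ω :=
              mul_le_mul_of_nonneg_right (le_abs_self _) (hf0 ω)
          _ ≤ |x ^ 2 - 1| * 1 := mul_le_mul_of_nonneg_left (hf1 ω) (abs_nonneg _)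
          _ = _ := mul_one _
      have hd : 1 / (4 * c) * (x + 1) ^ 2 = c * ((x + 1) / (2 * c)) ^ 2 := by
        field_simp
        ring
      have he : x ^ 2 - 1 = 2 * c * ((x - 1) * ((x + 1) / (2 * c))) := by
        field_simp
        ring
      refine ha.trans (abs_le.2 ⟨?_, ?_⟩)
      · rw [hd, he]
        nlinarith [mul_nonneg hc.le (sq_nonneg ((x - 1) + (x + 1) / (2 * c)))]
      · rw [hd, he]
        nlinarith [mul_nonneg hc.le (sq_nonneg ((x - 1) - (x + 1) / (2 * c)))]
    have h2 : c * (x - 1) ^ 2 ≤ c * (x ^ 2 - 1 + Λ ω) :=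
      mul_le_mul_of_nonneg_left (by nlinarith) hc.le
    have h3 : 1 / (4 * c) * (x + 1) ^ 2 ≤ 1 / (2 * c) * (x ^ 2 + 1) := by
      have : 1 / (2 * c) * (x ^ 2 + 1) = 1 / (4 * c) * (2 * (x ^ 2 + 1)) := by
        field_simp
        ring
      rw [this]
      exact mul_le_mul_of_nonneg_left (by nlinarith [sq_nonneg (x - 1)]) (by positivity)
    rw [hQ, hxx]
    nlinarith [mul_le_mul_of_nonneg_left (h1.trans (add_le_add h2 h3)) (hP ω)]
  refine (sum_le_sum fun ω _ => key ω).trans_eq ?_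
  simp only [sum_add_distrib, ← mul_sum, sum_sub_distrib, hP1, hQ1]
  field_simp
  ring

lemma card_mul_sum_eq_sum_sum_update {ι κ : Type*} [Fintype ι] [DecidableEq ι] [Fintype κ]
    (i : ι) (G : (ι → κ) → ℝ) :
    (Fintype.card κ : ℝ) * ∑ θ, G θ = ∑ θ, ∑ a, G (Function.update θ i a) := by
  classical
  let e : (ι → κ) × κ → (ι → κ) × κ := fun x => (Function.update x.1 i x.2, x.1 i)
  have he : Function.Involutive e := fun x => by simp [e]
  rw [← Fintype.sum_prod_type' (f := fun θ a => G (Function.update θ i a))]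
  have h := Equiv.sum_comp he.toPerm (fun x : (ι → κ) × κ => G x.1)
  simp only [Function.Involutive.coe_toPerm, e] at h
  rw [h, Fintype.sum_prod_type]
  simp [mul_sum]

section AlgLaw

variable {H : ℕ}

/-- The episode along a state-action path when rewards are deterministic. -/
def pathEpisode (r : ℕ → S → A → ℝ) (p : Fin H → S × A) : Episode S A H :=
  (p, fun t => r t (p t).1 (p t).2)

/-- The law of the `k`-th path given the previous ones, with deterministic rewards. -/
def pathKernel (M : MDP S A) (r : ℕ → S → A → ℝ)
    (behav : (k : ℕ) → (Fin k → Episode S A H) → (ℕ → S → A → ℝ))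
    (k : ℕ) (ω : Fin k → Fin H → S × A) (p : Fin H → S × A) : ℝ :=
  pathWeight M (behav k fun i => pathEpisode r (ω i)) p

lemma pathKernel_nonneg (M : MDP S A) (r : ℕ → S → A → ℝ)
    {behav : (k : ℕ) → (Fin k → Episode S A H) → (ℕ → S → A → ℝ)}
    (hbehav : ∀ k Dk, IsPolicy (behav k Dk)) (k : ℕ) (ω : Fin k → Fin H → S × A)
    (p : Fin H → S × A) : 0 ≤ pathKernel M r behav k ω p :=
  pathWeight_nonneg M (hbehav _ _) p

lemma sum_pathKernel (M : MDP S A) (r : ℕ → S → A → ℝ)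
    {behav : (k : ℕ) → (Fin k → Episode S A H) → (ℕ → S → A → ℝ)}
    (hbehav : ∀ k Dk, IsPolicy (behav k Dk)) (hH : 2 ≤ H) (k : ℕ)
    (ω : Fin k → Fin H → S × A) : ∑ p, pathKernel M r behav k ω p = 1 :=
  sum_pathWeight M (hbehav _ _) hH

variable [MeasurableSpace S] [MeasurableSpace A]

lemma episodeLaw_dirac (M : MDP S A) (μ r : ℕ → S → A → ℝ) :
    episodeLaw M μ (fun t s a => Measure.dirac (r t s a)) H =
      ∑ p : Fin H → S × A, ENNReal.ofReal (pathWeight M μ p) •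
        Measure.dirac (pathEpisode r p) := by
  unfold episodeLaw
  refine sum_congr rfl fun p _ => ?_
  have : (Measure.pi fun t : Fin H => Measure.dirac (r (t : ℕ) (p t).1 (p t).2)) =
      Measure.dirac (fun t : Fin H => r (t : ℕ) (p t).1 (p t).2) := by
    refine Measure.pi_eq fun s hs => ?_
    classical
    simp [Measure.dirac_apply, Set.indicator, Finset.prod_ite_zero]
  rw [this, Measure.dirac_prod_dirac]
  rfl

variable [MeasurableSingletonClass S] [MeasurableSingletonClass A]

lemma algLaw_dirac (M : MDP S A) (r : ℕ → S → A → ℝ)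
    (behav : (k : ℕ) → (Fin k → Episode S A H) → (ℕ → S → A → ℝ))
    (hbehav : ∀ k Dk, IsPolicy (behav k Dk)) (n : ℕ) :
    algLaw M (fun t s a => Measure.dirac (r t s a)) H behav n =
      ∑ ω : Fin n → Fin H → S × A, ENNReal.ofReal (seqWeight (pathKernel M r behav) n ω) •
        Measure.dirac (fun i => pathEpisode r (ω i)) := by
  induction n with
  | zero =>
    simp only [algLaw, seqWeight, univ_unique, sum_singleton, ENNReal.ofReal_one, one_smul]
    congr 1
    exact Subsingleton.elim _ _
  | succ n ih =>
    ext E hE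
    have hae : AEMeasurable (fun Dk : Fin n → Episode S A H =>
        Measure.map (Fin.snoc (α := fun _ => Episode S A H) Dk)
          (episodeLaw M (behav n Dk) (fun t s a => Measure.dirac (r t s a)) H))
        (algLaw M (fun t s a => Measure.dirac (r t s a)) H behav n) := by
      rw [ih]
      classical
      rw [← Measure.sum_fintype]
      exact AEMeasurable.sum_measure fun ω => aemeasurable_dirac.smul_measure _
    have hsnoc : ∀ Dk : Fin n → Episode S A H, Measurable
        (Fin.snoc (α := fun _ => Episode S A H) Dk) := by
      intro Dk
      refine measurable_pi_lambda _ fun i => ?_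
      induction i using Fin.lastCases with
      | last => simpa only [Fin.snoc_last (α := fun _ => Episode S A H)] using measurable_id'
      | cast i =>
        simpa only [Fin.snoc_castSucc (α := fun _ => Episode S A H)] using measurable_const
    have hpe : ∀ (ω : Fin n → Fin H → S × A) (x : Fin H → S × A),
        (Fin.snoc (fun i => pathEpisode r (ω i)) (pathEpisode r x) :
          Fin (n + 1) → Episode S A H) =
        fun i => pathEpisode r ((Fin.snoc ω x : Fin (n + 1) → Fin H → S × A) i) := by
      intro ω x
      funext i
      induction i using Fin.lastCases with
      | last => simp
      | cast i => simp
    have hsum : ∀ f : (Fin (n + 1) → Fin H → S × A) → ENNReal,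
        ∑ ω, f ω = ∑ ω : Fin n → Fin H → S × A, ∑ x, f (Fin.snoc ω x) := by
      intro f
      rw [← (Fin.snocEquiv (fun _ : Fin (n + 1) => Fin H → S × A)).sum_comp,
        Fintype.sum_prod_type_right]
      rfl
    rw [algLaw, Measure.bind_apply hE hae, ih, lintegral_finsetSum_measure,
      Measure.finsetSum_apply, hsum]
    refine sum_congr rfl fun ω _ => ?_
    rw [lintegral_smul_measure, lintegral_dirac, Measure.map_apply (hsnoc _) hE,
      episodeLaw_dirac, Measure.finsetSum_apply, smul_eq_mul, mul_sum]
    refine sum_congr rfl fun x _ => ?_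
    rw [seqWeight_snoc, ENNReal.ofReal_mul
      (seqWeight_nonneg (pathKernel_nonneg M r hbehav) n ω), Measure.smul_apply,
      Measure.smul_apply, Measure.dirac_apply' _ ((hsnoc _) hE), Measure.dirac_apply' _ hE,
      ← hpe, smul_eq_mul, smul_eq_mul, mul_assoc]
    rfl

lemma ofReal_sum_le_algLaw_dirac (M : MDP S A) (r : ℕ → S → A → ℝ)
    (behav : (k : ℕ) → (Fin k → Episode S A H) → (ℕ → S → A → ℝ))
    (hbehav : ∀ k Dk, IsPolicy (behav k Dk)) (n : ℕ) (E : Set (Dataset S A H n))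
    (f : (Fin n → Fin H → S × A) → ℝ) (hf0 : ∀ ω, 0 ≤ f ω) (hf1 : ∀ ω, f ω ≤ 1)
    (hfE : ∀ ω, f ω ≠ 0 → (fun i => pathEpisode r (ω i)) ∈ E) :
    ENNReal.ofReal (∑ ω, seqWeight (pathKernel M r behav) n ω * f ω) ≤
      algLaw M (fun t s a => Measure.dirac (r t s a)) H behav n E := by
  have hw := seqWeight_nonneg (pathKernel_nonneg M r hbehav) n
  rw [algLaw_dirac M r behav hbehav, Measure.finsetSum_apply,
    ENNReal.ofReal_sum_of_nonneg fun ω _ => mul_nonneg (hw ω) (hf0 ω)]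
  refine sum_le_sum fun ω _ => ?_
  rw [Measure.smul_apply, smul_eq_mul, ENNReal.ofReal_mul (hw ω)]
  gcongr
  by_cases h : f ω = 0
  · simp [h]
  · rw [Measure.dirac_apply, Set.indicator_of_mem (hfE ω h)]
    simpa using hf1 ω

end AlgLaw
/-- Parameters of the hard instances: a rewarding absorbing state `good`, a non-rewarding absorbing
state `bad`, and waiting states which are left with probability `q` at each time before `L`; the
hidden action of a waiting state shifts the chance of leaving towards `good` by `τ`. -/
structure HardFamily (S : Type) [Fintype S] where
  good : S
  bad : S
  good_ne_bad : good ≠ bad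
  L : ℕ
  q : ℝ
  τ : ℝ
  q_nonneg : 0 ≤ q
  q_le_one : q ≤ 1
  τ_nonneg : 0 ≤ τ
  τ_sq_le : τ ^ 2 ≤ 1 / 8
  two_lt_card : 2 < Fintype.card S

namespace HardFamily

variable (F : HardFamily S)

/-- The non-absorbing states. -/
def waiting : Finset S := univ.filter fun s => s ≠ F.good ∧ s ≠ F.bad

/-- The shift of the transition probability towards `good` under hidden actions `θ`. -/
def bonus (θ : Fin F.L × S → Option A) (t : ℕ) (s : S) (a : A) : ℝ :=
  if h : t < F.L then (if θ (⟨t, h⟩, s) = some a then F.τ else 0) else 0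

/-- The transition kernel of a hard instance. -/
def kernel (θ : Fin F.L × S → Option A) (t : ℕ) (s : S) (a : A) (s' : S) : ℝ :=
  if s ∈ F.waiting ∧ t < F.L then
    (if s' = s then 1 - F.q else 0) + (if s' = F.good then F.q * (1 / 2 + F.bonus θ t s a) else 0) +
      (if s' = F.bad then F.q * (1 / 2 - F.bonus θ t s a) else 0)
  else if s' = s then 1 else 0

/-- The reward function of the hard instances. -/
def reward (t : ℕ) (s : S) (_ : A) : ℝ := if s = F.good ∧ F.L ≤ t then 1 else 0

lemma τ_le_half : F.τ ≤ 1 / 2 := by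
  have := F.τ_sq_le
  have := F.τ_nonneg
  nlinarith

lemma bonus_nonneg (θ : Fin F.L × S → Option A) (t : ℕ) (s : S) (a : A) :
    0 ≤ F.bonus θ t s a := by
  unfold bonus
  have := F.τ_nonneg
  split_ifs <;> linarith

lemma bonus_le (θ : Fin F.L × S → Option A) (t : ℕ) (s : S) (a : A) :
    F.bonus θ t s a ≤ F.τ := by
  unfold bonus
  have := F.τ_nonneg
  split_ifs <;> linarith

lemma sum_kernel_mul (θ : Fin F.L × S → Option A) {t : ℕ} {s : S} (hs : s ∈ F.waiting)
    (ht : t < F.L) (a : A) (f : S → ℝ) :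
    ∑ s', F.kernel θ t s a s' * f s' = (1 - F.q) * f s +
      F.q * (1 / 2 + F.bonus θ t s a) * f F.good + F.q * (1 / 2 - F.bonus θ t s a) * f F.bad := by
  simp [kernel, hs, ht, add_mul, sum_add_distrib, ite_mul]

lemma sum_kernel_mul_of_not (θ : Fin F.L × S → Option A) {t : ℕ} {s : S}
    (h : ¬(s ∈ F.waiting ∧ t < F.L)) (a : A) (f : S → ℝ) :
    ∑ s', F.kernel θ t s a s' * f s' = f s := by
  simp [kernel, h, ite_mul]

lemma card_waiting : (F.waiting.card : ℝ) = Fintype.card S - 2 := by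
  have h : F.waiting = univ \ {F.good, F.bad} := by
    ext s
    simp [waiting, not_or]
  rw [h, card_sdiff_of_subset (subset_univ _), card_pair F.good_ne_bad, card_univ,
    Nat.cast_sub F.two_lt_card.le]
  norm_num

lemma card_waiting_pos : (0 : ℝ) < F.waiting.card := by
  rw [card_waiting]
  have : (2 : ℝ) < Fintype.card S := by exact_mod_cast F.two_lt_card
  linarith

/-- The hard instance with hidden actions `θ`. -/
def mdp (θ : Fin F.L × S → Option A) : MDP S A where
  P := F.kernel θ
  P_nonneg t s a s' := by
    have h0 := F.q_nonneg
    have h1 := F.q_le_one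
    have h2 := F.τ_le_half
    have h3 := F.bonus_nonneg θ t s a
    have h4 := F.bonus_le θ t s a
    have h5 : 0 ≤ F.q * (1 / 2 + F.bonus θ t s a) := mul_nonneg h0 (by linarith)
    have h6 : 0 ≤ F.q * (1 / 2 - F.bonus θ t s a) := mul_nonneg h0 (by linarith)
    unfold kernel
    split_ifs <;> linarith
  P_sum t s a := by
    have hw := F.sum_kernel_mul θ (t := t) (s := s)
    have hn := F.sum_kernel_mul_of_not θ (t := t) (s := s)
    by_cases h : s ∈ F.waiting ∧ t < F.L
    · have := hw h.1 h.2 a (fun _ => 1)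
      simp only [mul_one] at this
      rw [this]
      ring
    · simpa using hn h a (fun _ => 1)
  r := F.reward
  r_nonneg t s a := by unfold reward; split_ifs <;> norm_num
  r_le_one t s a := by unfold reward; split_ifs <;> norm_num
  d₁ s := if s ∈ F.waiting then (F.waiting.card : ℝ)⁻¹ else 0
  d₁_nonneg s := by split_ifs <;> positivity
  d₁_sum := by
    rw [sum_ite_mem, univ_inter, sum_const, nsmul_eq_mul, mul_inv_cancel₀ F.card_waiting_pos.ne']

lemma margDist_waiting (θ : Fin F.L × S → Option A) {π : ℕ → S → A → ℝ} (hπ : IsPolicy π) {s : S}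
    (hs : s ∈ F.waiting) {t : ℕ} (ht : t ≤ F.L) (a : A) :
    margDist (F.mdp θ).P (F.mdp θ).d₁ π t (s, a) =
      (F.waiting.card : ℝ)⁻¹ * (1 - F.q) ^ t * π t s a := by
  induction t generalizing a with
  | zero => simp [margDist, mdp, hs]
  | succ t ih =>
    have hs' : s ≠ F.good ∧ s ≠ F.bad := by simpa [waiting] using hs
    have hP : ∀ p : S × A, (F.mdp θ).P t p.1 p.2 s = if p.1 = s then 1 - F.q else 0 := by
      rintro ⟨z, a'⟩
      by_cases hz : z = s
      · subst hz
        simp [mdp, kernel, hs, hs'.1, hs'.2, show t < F.L by omega]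
      · simp [mdp, kernel, hs'.1, hs'.2, hz, Ne.symm hz]
    simp only [margDist, hP]
    rw [Fintype.sum_prod_type]
    simp only [ite_mul, zero_mul, sum_ite_irrel, sum_const_zero, sum_ite_eq', mem_univ, if_true]
    rw [sum_congr rfl fun a' _ => by rw [ih (by omega) a'], ← mul_sum, ← mul_sum, hπ.2]
    ring

/-- The optimal value of a waiting state, `j` steps before time `L`. -/
def waitValue (V : ℝ) : ℕ → ℝ
  | 0 => 0
  | j + 1 => F.q * (1 / 2 + F.τ) * V + (1 - F.q) * waitValue V j

/-- The optimal value function of the hard instances. -/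
def optValue (H t : ℕ) (s : S) : ℝ :=
  if s ∈ F.waiting then F.waitValue ((H - F.L : ℕ) : ℝ) (F.L - t)
  else if s = F.good then ((H - max t F.L : ℕ) : ℝ) else 0

lemma good_notMem_waiting : F.good ∉ F.waiting := by simp [waiting]

lemma bad_notMem_waiting : F.bad ∉ F.waiting := by simp [waiting]

lemma optValue_sub (θ : Fin F.L × S → Option A) {H t : ℕ} (ht : t < H) (s : S) (a : A) :
    F.optValue H t s - (F.mdp θ).r t s a - ∑ s', (F.mdp θ).P t s a s' * F.optValue H (t + 1) s' =
      if s ∈ F.waiting ∧ t < F.L then F.q * ((H - F.L : ℕ) : ℝ) * (F.τ - F.bonus θ t s a)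
      else 0 := by
  have hg := F.good_notMem_waiting
  have hb := F.bad_notMem_waiting
  by_cases h : s ∈ F.waiting ∧ t < F.L
  · have hs : s ≠ F.good := fun e => hg (e ▸ h.1)
    obtain ⟨j, hj⟩ : ∃ j, F.L - t = j + 1 := ⟨F.L - t - 1, by omega⟩
    have hj' : F.L - (t + 1) = j := by omega
    simp only [mdp, F.sum_kernel_mul θ h.1 h.2, reward, hs, optValue, h.1, h.2, hg, hb, hj, hj',
      F.good_ne_bad.symm, if_true, if_false, and_self, false_and, waitValue,
      max_eq_right (show t + 1 ≤ F.L by omega)]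
    ring
  · rw [if_neg h]
    simp only [mdp, F.sum_kernel_mul_of_not θ h]
    by_cases hs : s ∈ F.waiting
    · have hs' : s ≠ F.good := fun e => hg (e ▸ hs)
      have ht' : F.L ≤ t := by
        by_contra hc
        exact h ⟨hs, by omega⟩
      simp [optValue, hs, reward, hs', Nat.sub_eq_zero_of_le ht',
        Nat.sub_eq_zero_of_le (ht'.trans (Nat.le_succ t)), waitValue]
    · by_cases hs' : s = F.good
      · by_cases ht' : F.L ≤ t
        · have : ((H - t : ℕ) : ℝ) = ((H - (t + 1) : ℕ) : ℝ) + 1 := by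
            exact_mod_cast (by omega : H - t = H - (t + 1) + 1)
          simp [optValue, reward, hs', hg, ht',
            max_eq_left (ht'.trans (Nat.le_succ t)), this]
        · simp [optValue, reward, hs', hg, ht', max_eq_right (show t ≤ F.L by omega),
            max_eq_right (show t + 1 ≤ F.L by omega)]
      · simp [optValue, hs, reward, hs']

lemma optValue_horizon {H : ℕ} (hL : F.L ≤ H) (s : S) : F.optValue H H s = 0 := by
  simp [optValue, Nat.sub_eq_zero_of_le hL, max_eq_left hL, waitValue]

/-- The regret on a hard instance is bounded below by the probability of missing the hidden
actions. -/
lemma le_regret (θ : Fin F.L × S → A) {H : ℕ} (hL : F.L ≤ H)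
    (hq : ∀ t < F.L, (1 : ℝ) / 2 ≤ (1 - F.q) ^ t) {π : ℕ → S → A → ℝ} (hπ : IsPolicy π) :
    F.q * ((H - F.L : ℕ) : ℝ) * F.τ / (2 * F.waiting.card) *
        ∑ c ∈ (univ : Finset (Fin F.L)) ×ˢ F.waiting, (1 - π c.1 c.2 (θ c)) ≤
      vStar (F.mdp (some ∘ θ)) H -
        polValue (F.mdp (some ∘ θ)).P (F.mdp (some ∘ θ)).r (F.mdp (some ∘ θ)).d₁ π H := by
  set M := F.mdp (some ∘ θ) with hM
  have hU := F.optValue_horizon hL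
  have hgap := fun t (ht : t < H) s a => F.optValue_sub (some ∘ θ) ht s a
  have hbonus : ∀ (t : Fin F.L) s a, F.bonus (some ∘ θ) t s a = if θ (t, s) = a then F.τ else 0 := by
    intro t s a
    simp [bonus]
  have h1 : ∑ s, M.d₁ s * F.optValue H 0 s ≤ vStar M H := by
    refine le_vStar M H _ hU fun t ht s => ?_
    by_cases h : s ∈ F.waiting ∧ t < F.L
    · refine ⟨θ (⟨t, h.2⟩, s), ?_⟩
      have hb := hbonus ⟨t, h.2⟩ s (θ (⟨t, h.2⟩, s))
      have := hgap t ht s (θ (⟨t, h.2⟩, s))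
      simp only [if_true] at hb
      rw [if_pos h, hb] at this
      linarith
    · refine ⟨default, ?_⟩
      have := hgap t ht s default
      rw [if_neg h] at this
      linarith
  have h2 := sum_d₁_mul_sub_polValue M hπ _ H hU
  refine le_trans ?_ ((h2.symm.le).trans (sub_le_sub_right h1 _))
  have hnn : 0 ≤ F.q * ((H - F.L : ℕ) : ℝ) * F.τ :=
    mul_nonneg (mul_nonneg F.q_nonneg (Nat.cast_nonneg _)) F.τ_nonneg
  have hterm : ∀ t ∈ range H, ∑ q : S × A, margDist M.P M.d₁ π t q *
      (F.optValue H t q.1 - M.r t q.1 q.2 - ∑ s', M.P t q.1 q.2 s' * F.optValue H (t + 1) s') =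
      ∑ q : S × A, margDist M.P M.d₁ π t q *
        (if q.1 ∈ F.waiting ∧ t < F.L then
          F.q * ((H - F.L : ℕ) : ℝ) * (F.τ - F.bonus (some ∘ θ) t q.1 q.2) else 0) := by
    intro t ht
    exact sum_congr rfl fun q _ => by rw [hM, hgap t (mem_range.1 ht)]
  rw [sum_congr rfl hterm]
  have hsub : range F.L ⊆ range H := range_mono hL
  rw [← sum_subset hsub fun t _ ht => by simp [show ¬ t < F.L by simpa using ht],
    Finset.sum_range, sum_product, mul_sum]
  refine sum_le_sum fun t _ => ?_
  rw [Fintype.sum_prod_type, mul_sum]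
  simp only [t.2, and_true]
  rw [← sum_subset (subset_univ F.waiting) fun s _ hs => by simp [hs]]
  refine sum_le_sum fun s hs => ?_
  have hsum : ∑ a, margDist M.P M.d₁ π t (s, a) * (if s ∈ F.waiting then
      F.q * ((H - F.L : ℕ) : ℝ) * (F.τ - F.bonus (some ∘ θ) t s a) else 0) =
      (F.waiting.card : ℝ)⁻¹ * (1 - F.q) ^ (t : ℕ) * (F.q * ((H - F.L : ℕ) : ℝ) * F.τ) *
        (1 - π t s (θ (t, s))) := by
    have : ∀ a, margDist M.P M.d₁ π t (s, a) * (if s ∈ F.waiting then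
        F.q * ((H - F.L : ℕ) : ℝ) * (F.τ - F.bonus (some ∘ θ) t s a) else 0) =
        (F.waiting.card : ℝ)⁻¹ * (1 - F.q) ^ (t : ℕ) * (F.q * ((H - F.L : ℕ) : ℝ) * F.τ) *
          (π t s a - if θ (t, s) = a then π t s a else 0) := by
      intro a
      rw [hM, F.margDist_waiting _ hπ hs t.2.le, if_pos hs, hbonus]
      split_ifs <;> ring
    simp only [this]
    rw [← mul_sum, sum_sub_distrib, hπ.2]
    simp
  rw [hsum]
  have hle : π t s (θ (t, s)) ≤ 1 := by
    rw [← hπ.2 t s]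
    exact single_le_sum (f := π t s) (fun a _ => hπ.1 t s a) (mem_univ _)
  have := F.card_waiting_pos
  have e : F.q * ((H - F.L : ℕ) : ℝ) * F.τ / (2 * F.waiting.card) =
      (F.waiting.card : ℝ)⁻¹ * (1 / 2) * (F.q * ((H - F.L : ℕ) : ℝ) * F.τ) := by
    field_simp
  rw [e]
  have := hq t t.2
  have : 0 ≤ 1 - π t s (θ (t, s)) := by linarith
  gcongr

lemma neg_log_one_sub_le {x : ℝ} (h0 : 0 ≤ x) (h1 : x ≤ 1 / 2) : -Real.log (1 - x) ≤ 2 * x := by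
  have h := Real.one_sub_inv_le_log_of_pos (show 0 < 1 - x by linarith)
  have : (1 - x)⁻¹ ≤ 1 + 2 * x := by
    rw [inv_le_comm₀ (by linarith) (by linarith), inv_le_comm₀ (by linarith) (by linarith)]
    rw [inv_eq_one_div, div_le_iff₀ (by linarith)]
    nlinarith
  linarith

lemma two_mul_τ_lt_one : 2 * F.τ < 1 := by
  have := F.τ_sq_le
  have := F.τ_nonneg
  nlinarith

/-- The log-likelihood loss of observing the next state `s'` when a cell has no hidden action,
relative to the played action being the hidden one. -/
def stepLoss (s' : S) : ℝ :=
  -(if s' = F.good then Real.log (1 + 2 * F.τ)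
    else if s' = F.bad then Real.log (1 - 2 * F.τ) else 0)

/-- The log-likelihood loss of a path for the hidden action `a` at the cell `c`. -/
def pathLoss (c : Fin F.L × S) (a : A) {H : ℕ} (p : Fin H → S × A) : ℝ :=
  if pget p c.1 = (c.2, a) then F.stepLoss (pget p (c.1 + 1)).1 else 0

section Cell

variable {c : Fin F.L × S} {θ : Fin F.L × S → Option A}

lemma kernel_update (hc : c.2 ∈ F.waiting) (hθ : θ c = none) (a : A) (t : ℕ) (s : S) (a' : A)
    (s' : S) :
    F.kernel (Function.update θ c (some a)) t s a' s' =
      F.kernel θ t s a' s' *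
        Real.exp (-(if t = c.1 ∧ s = c.2 ∧ a' = a then F.stepLoss s' else 0)) := by
  obtain ⟨t₀, i⟩ := c
  have hi : i ≠ F.good ∧ i ≠ F.bad := by simpa [waiting] using hc
  have hτ := F.two_mul_τ_lt_one
  have hτ0 := F.τ_nonneg
  by_cases h : t = t₀ ∧ s = i ∧ a' = a
  · obtain ⟨rfl, rfl, rfl⟩ := h
    have hg : Real.exp (Real.log (1 + 2 * F.τ)) = 1 + 2 * F.τ := Real.exp_log (by linarith)
    have hb : Real.exp (Real.log (1 - 2 * F.τ)) = 1 - 2 * F.τ := Real.exp_log (by linarith)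
    have h0 : F.bonus θ t₀ s a' = 0 := by simp [bonus, hθ]
    have h1 : F.bonus (Function.update θ (t₀, s) (some a')) t₀ s a' = F.τ := by simp [bonus]
    simp only [kernel, h0, h1, hc, t₀.2, and_self, if_true, stepLoss, neg_neg]
    by_cases e1 : s' = F.good
    · subst e1
      simp [hi.1.symm, F.good_ne_bad, hg]
      ring
    · by_cases e2 : s' = F.bad
      · subst e2
        simp [hi.2.symm, F.good_ne_bad.symm, hb]
        ring
      · simp [e1, e2]
  · rw [if_neg h, neg_zero, Real.exp_zero, mul_one]
    have : F.bonus (Function.update θ (t₀, i) (some a)) t s a' = F.bonus θ t s a' := by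
      unfold bonus
      by_cases ht : t < F.L
      · simp only [ht, dif_pos]
        by_cases hts : t = t₀ ∧ s = i
        · obtain ⟨rfl, rfl⟩ := hts
          have : a ≠ a' := fun e => h ⟨rfl, rfl, e.symm⟩
          simp [hθ, this]
        · rw [Function.update_of_ne]
          intro e
          rw [Prod.mk.injEq, Fin.ext_iff] at e
          exact hts e
      · simp [ht]
    simp only [kernel, this]

lemma pathWeight_update (hc : c.2 ∈ F.waiting) (hθ : θ c = none) (a : A) {H : ℕ} (hH : F.L < H)
    (μ : ℕ → S → A → ℝ) (p : Fin H → S × A) :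
    pathWeight (F.mdp (Function.update θ c (some a))) μ p =
      pathWeight (F.mdp θ) μ p * Real.exp (-F.pathLoss c a p) := by
  have hloss : F.pathLoss c a p = ∑ t ∈ range (H - 1),
      (if t = c.1 ∧ (pget p t).1 = c.2 ∧ (pget p t).2 = a then
        F.stepLoss (pget p (t + 1)).1 else 0) := by
    rw [sum_eq_single_of_mem (c.1 : ℕ) (mem_range.2 (by omega)) fun t _ ht => by simp [ht]]
    simp [pathLoss, Prod.ext_iff]
  rw [hloss, ← sum_neg_distrib, Real.exp_sum]
  unfold pathWeight
  rw [mul_assoc ((F.mdp θ).d₁ _ * _), ← prod_mul_distrib]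
  refine congrArg₂ _ rfl (prod_congr rfl fun t _ => ?_)
  simp only [mdp]
  rw [F.kernel_update hc hθ]
  ring

lemma sum_pathWeight_mul_pathLoss_le (hc : c.2 ∈ F.waiting) (hθ : θ c = none) {H : ℕ}
    (hH : F.L < H) {μ : ℕ → S → A → ℝ} (hμ : IsPolicy μ) :
    ∑ p : Fin H → S × A, pathWeight (F.mdp θ) μ p * ∑ a, F.pathLoss c a p ≤
      4 * F.q * F.τ ^ 2 / F.waiting.card := by
  obtain ⟨t, i⟩ := c
  have hi : i ≠ F.good ∧ i ≠ F.bad := by simpa [waiting] using hc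
  have hloss : ∀ p : Fin H → S × A, ∑ a, F.pathLoss (t, i) a p =
      if (pget p t).1 = i then F.stepLoss (pget p (t + 1)).1 else 0 := by
    intro p
    simp only [pathLoss, Prod.ext_iff]
    by_cases h : (pget p (t : ℕ)).1 = i <;> simp [h]
  simp only [hloss]
  rw [sum_pathWeight_mul_step (F.mdp θ) hμ (t := t) (by omega)
    (fun q s' => if q.1 = i then F.stepLoss s' else 0), Fintype.sum_prod_type]
  have hinner : ∀ s a, margDist (F.mdp θ).P (F.mdp θ).d₁ μ t (s, a) *
      ∑ s', (F.mdp θ).P t s a s' * (if s = i then F.stepLoss s' else 0) =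
      if s = i then (F.waiting.card : ℝ)⁻¹ * (1 - F.q) ^ (t : ℕ) *
        (F.q / 2 * -Real.log (1 - 4 * F.τ ^ 2)) * μ t i a else 0 := by
    intro s a
    by_cases h : s = i
    · subst h
      have hlog : Real.log (1 - 4 * F.τ ^ 2) =
          Real.log (1 + 2 * F.τ) + Real.log (1 - 2 * F.τ) := by
        have h1 := F.two_mul_τ_lt_one
        have h2 := F.τ_nonneg
        rw [← Real.log_mul (by linarith) (by linarith)]
        congr 1
        ring
      have hb : F.bonus θ t s a = 0 := by simp [bonus, hθ]
      simp only [if_true]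
      rw [F.margDist_waiting θ hμ hc t.2.le]
      simp only [mdp]
      rw [F.sum_kernel_mul θ hc t.2, hb, hlog]
      simp only [stepLoss, hi.1, hi.2, F.good_ne_bad.symm, if_true, if_false]
      ring
    · simp [h]
  simp only [hinner, sum_ite_irrel, sum_const_zero, sum_ite_eq', mem_univ, if_true]
  rw [← mul_sum, hμ.2, mul_one]
  have hW := F.card_waiting_pos
  have hq0 := F.q_nonneg
  have hq1 := F.q_le_one
  have hτ := F.τ_sq_le
  have hlog := neg_log_one_sub_le (x := 4 * F.τ ^ 2) (by positivity) (by linarith)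
  calc (F.waiting.card : ℝ)⁻¹ * (1 - F.q) ^ (t : ℕ) * (F.q / 2 * -Real.log (1 - 4 * F.τ ^ 2))
      ≤ (F.waiting.card : ℝ)⁻¹ * 1 * (F.q / 2 * (2 * (4 * F.τ ^ 2))) := by
        have h1 : (1 - F.q) ^ (t : ℕ) ≤ 1 := pow_le_one₀ (by linarith) (by linarith)
        have h2 : 0 ≤ -Real.log (1 - 4 * F.τ ^ 2) := by
          rw [neg_nonneg]
          exact Real.log_nonpos (by linarith) (by nlinarith [sq_nonneg F.τ])
        gcongr
    _ = 4 * F.q * F.τ ^ 2 / F.waiting.card := by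
        field_simp

/-- On average over the hidden action at the cell `c`, the expected chance of playing it is
small. -/
lemma sum_expect_hidden_le (hc : c.2 ∈ F.waiting) (hθ : θ c = none) {H : ℕ} (hL : 0 < F.L)
    (hH : F.L < H) {behav : (k : ℕ) → (Fin k → Episode S A H) → (ℕ → S → A → ℝ)}
    (hbehav : ∀ k Dk, IsPolicy (behav k Dk)) (n : ℕ)
    (f : (Fin n → Fin H → S × A) → A → ℝ) (hf0 : ∀ ω a, 0 ≤ f ω a) (hf1 : ∀ ω, ∑ a, f ω a = 1)
    {l : ℝ} (hl : 0 < l) :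
    ∑ a, ∑ ω, seqWeight (pathKernel (F.mdp (Function.update θ c (some a))) F.reward behav) n ω *
        f ω a ≤
      1 + l * (n * (4 * F.q * F.τ ^ 2 / F.waiting.card)) + Fintype.card A / l := by
  have hH2 : 2 ≤ H := by omega
  set P := seqWeight (pathKernel (F.mdp θ) F.reward behav) n with hP
  have hP0 : ∀ ω, 0 ≤ P ω := seqWeight_nonneg (pathKernel_nonneg (F.mdp θ) F.reward hbehav) n
  have hP1 : ∑ ω, P ω = 1 :=
    sum_seqWeight (sum_pathKernel (F.mdp θ) F.reward hbehav hH2) n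
  have hle : ∀ a, ∑ ω, seqWeight (pathKernel (F.mdp (Function.update θ c (some a)))
      F.reward behav) n ω * f ω a ≤
      ∑ ω, P ω * f ω a + l * ∑ ω, P ω * ∑ i, F.pathLoss c a (ω i) + 1 / l := by
    intro a
    refine sum_mul_le_of_exp_tilt hP0 hP1
      (sum_seqWeight (sum_pathKernel _ F.reward hbehav hH2) n) (fun ω => ?_)
      (fun ω => hf0 ω a) (fun ω => ?_) hl
    · exact seqWeight_tilt (fun k ω x => F.pathWeight_update hc hθ a hH _ x) n ω
    · rw [← hf1 ω]
      exact single_le_sum (f := f ω) (fun a _ => hf0 ω a) (mem_univ _)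
  refine (sum_le_sum fun a _ => hle a).trans ?_
  have hinfo := sum_seqWeight_mul_sum_le (pathKernel_nonneg (F.mdp θ) F.reward hbehav)
    (sum_pathKernel (F.mdp θ) F.reward hbehav hH2)
    (fun k ω => F.sum_pathWeight_mul_pathLoss_le hc hθ hH (hbehav k _)) n
  have h1 : ∑ a, ∑ ω, P ω * f ω a = 1 := by
    rw [sum_comm]
    simp only [← mul_sum, hf1, mul_one, hP1]
  have h2 : ∑ a, ∑ ω, P ω * ∑ i, F.pathLoss c a (ω i) =
      ∑ ω, P ω * ∑ i, ∑ a, F.pathLoss c a (ω i) := by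
    rw [sum_comm]
    refine sum_congr rfl fun ω _ => ?_
    rw [← mul_sum, sum_comm]
  rw [sum_add_distrib, sum_add_distrib, h1, ← mul_sum, h2, sum_const, nsmul_eq_mul, card_univ,
    mul_one_div]
  gcongr

end Cell

/-- Some choice of hidden actions is missed with expected average probability at least `1 / 4`. -/
lemma exists_le_expect_miss {H : ℕ} (hL : 0 < F.L) (hH : F.L < H) (hA : 2 ≤ Fintype.card A)
    {behav : (k : ℕ) → (Fin k → Episode S A H) → (ℕ → S → A → ℝ)}
    (hbehav : ∀ k Dk, IsPolicy (behav k Dk)) (n : ℕ)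
    (hn : 256 * (n * (F.q * F.τ ^ 2)) ≤ Fintype.card A * F.waiting.card)
    (f : (Fin n → Fin H → S × A) → ℕ → S → A → ℝ) (hf : ∀ ω, IsPolicy (f ω)) :
    ∃ θ : Fin F.L × S → A, (F.L * F.waiting.card : ℝ) / 4 ≤
      ∑ ω, seqWeight (pathKernel (F.mdp (some ∘ θ)) F.reward behav) n ω *
        ∑ c ∈ (univ : Finset (Fin F.L)) ×ˢ F.waiting, (1 - f ω c.1 c.2 (θ c)) := by
  have hA' : (2 : ℝ) ≤ Fintype.card A := by exact_mod_cast hA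
  have hW := F.card_waiting_pos
  set N : ℝ := (Fintype.card (Fin F.L × S → A) : ℝ) with hN
  have hcell : ∀ c ∈ (univ : Finset (Fin F.L)) ×ˢ F.waiting,
      ∑ θ : Fin F.L × S → A, ∑ ω,
        seqWeight (pathKernel (F.mdp (some ∘ θ)) F.reward behav) n ω * f ω c.1 c.2 (θ c) ≤
      3 / 4 * N := by
    intro c hc
    have hcw : c.2 ∈ F.waiting := (mem_product.1 hc).2
    have h := card_mul_sum_eq_sum_sum_update c (fun θ : Fin F.L × S → A =>
      ∑ ω, seqWeight (pathKernel (F.mdp (some ∘ θ)) F.reward behav) n ω * f ω c.1 c.2 (θ c))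
    have hθ : ∀ θ : Fin F.L × S → A, ∑ a, ∑ ω,
        seqWeight (pathKernel (F.mdp (some ∘ Function.update θ c a)) F.reward behav) n ω *
          f ω c.1 c.2 (Function.update θ c a c) ≤ 3 / 4 * Fintype.card A := by
      intro θ
      have h1 := F.sum_expect_hidden_le (θ := Function.update (some ∘ θ) c none) hcw
        (Function.update_self _ _ _) hL hH hbehav n (fun ω a => f ω c.1 c.2 a)
        (fun ω a => (hf ω).1 _ _ _) (fun ω => (hf ω).2 _ _) (l := 8) (by norm_num)
      simp only [Function.update_idem] at h1
      simp only [Function.comp_update, Function.update_self]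
      have h2 : 8 * (n * (4 * F.q * F.τ ^ 2 / F.waiting.card)) ≤ (Fintype.card A : ℝ) / 8 := by
        rw [show 8 * (n * (4 * F.q * F.τ ^ 2 / F.waiting.card)) =
          256 * (n * (F.q * F.τ ^ 2)) / F.waiting.card / 8 by ring]
        gcongr
        rwa [div_le_iff₀ hW]
      linarith
    have h' := h.trans_le (sum_le_sum fun θ _ => hθ θ)
    rw [sum_const, nsmul_eq_mul, card_univ, ← hN] at h'
    refine le_of_mul_le_mul_left (h'.trans_eq ?_) (show (0 : ℝ) < Fintype.card A by linarith)
    ring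
  have htot : ∀ θ : Fin F.L × S → A, ∑ ω,
      seqWeight (pathKernel (F.mdp (some ∘ θ)) F.reward behav) n ω *
        ∑ c ∈ (univ : Finset (Fin F.L)) ×ˢ F.waiting, (1 - f ω c.1 c.2 (θ c)) =
      F.L * F.waiting.card - ∑ c ∈ (univ : Finset (Fin F.L)) ×ˢ F.waiting, ∑ ω,
        seqWeight (pathKernel (F.mdp (some ∘ θ)) F.reward behav) n ω * f ω c.1 c.2 (θ c) := by
    intro θ
    have h1 := sum_seqWeight (sum_pathKernel (F.mdp (some ∘ θ)) F.reward hbehav (by omega)) n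
    simp only [sum_sub_distrib, mul_sub, sum_const, card_product, card_univ, Fintype.card_fin,
      nsmul_eq_mul, Nat.cast_mul, mul_one]
    rw [← sum_mul, h1, one_mul, sum_comm (s := univ ×ˢ F.waiting)]
    simp only [mul_sum]
  obtain ⟨θ, -, hθ⟩ := exists_le_of_sum_le (s := (univ : Finset (Fin F.L × S → A)))
    (f := fun _ => (F.L * F.waiting.card : ℝ) / 4) univ_nonempty (g := fun θ => ∑ ω,
      seqWeight (pathKernel (F.mdp (some ∘ θ)) F.reward behav) n ω *
        ∑ c ∈ (univ : Finset (Fin F.L)) ×ˢ F.waiting, (1 - f ω c.1 c.2 (θ c))) (by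
      simp only [htot]
      rw [sum_sub_distrib, sum_comm, sum_const, sum_const, nsmul_eq_mul, nsmul_eq_mul, card_univ,
        ← hN]
      have := sum_le_sum hcell
      rw [sum_const, nsmul_eq_mul, card_product, card_univ, Fintype.card_fin, Nat.cast_mul] at this
      linarith)
  exact ⟨θ, hθ⟩

end HardFamily

/-- Theorem G.1: for any `H ≥ 2`, `A ≥ 2`, `0 < ε < 1/(48√8)` and `S ≥ c₁`,
and any (possibly adaptive) learning algorithm collecting `n ≤ c H³SA/ε²` episodes, there is a
time-inhomogeneous `H`-horizon MDP with rewards in `[0,1]` on which the output policy is not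
`ε`-optimal with probability at least `1/12`. -/
theorem offline_learning_minimax_lower_bound_all_instances :
    ∃ c₁ c : ℝ, 0 < c₁ ∧ 0 < c ∧
      ∀ (S A : Type) [Fintype S] [Fintype A] [DecidableEq S] [DecidableEq A]
        [Inhabited S] [Inhabited A]
        [MeasurableSpace S] [MeasurableSingletonClass S]
        [MeasurableSpace A] [MeasurableSingletonClass A]
        (H n : ℕ) (ε : ℝ),
        2 ≤ H → 2 ≤ Fintype.card A → c₁ ≤ (Fintype.card S : ℝ) →
        0 < ε → ε < 1 / (48 * Real.sqrt 8) →
        (n : ℝ) ≤ c * (H : ℝ) ^ 3 * (Fintype.card S : ℝ) * (Fintype.card A : ℝ) / ε ^ 2 →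
        ∀ behav : (k : ℕ) → (Fin k → Episode S A H) → (ℕ → S → A → ℝ),
          (∀ k Dk, IsPolicy (behav k Dk)) → (∀ k, Measurable (behav k)) →
          ∀ out : Dataset S A H n → (ℕ → S → A → ℝ),
            (∀ D, IsPolicy (out D)) → Measurable out →
            ∃ (M : MDP S A) (R : ℕ → S → A → Measure ℝ),
              ValidReward M R ∧
              ENNReal.ofReal (1 / 12) ≤
                algLaw M R H behav n
                  {D | ε ≤ vStar M H - polValue M.P M.r M.d₁ (out D) H} := by
  refine ⟨4, 1 / 4718592, by norm_num, by norm_num, ?_⟩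
  intro S A _ _ _ _ _ _ _ _ _ _ H n ε hH hA hS hε hε' hn behav hbehav _ out hout _
  have hHr : (2 : ℝ) ≤ H := by exact_mod_cast hH
  have hS4 : 4 ≤ Fintype.card S := by exact_mod_cast hS
  have hpow : ∀ t < H / 2, (1 : ℝ) / 2 ≤ (1 - 1 / (H : ℝ)) ^ t := by
    intro t ht
    have h2 : (2 * t : ℝ) ≤ H := by exact_mod_cast (by omega : 2 * t ≤ H)
    have h3 : 1 / (H : ℝ) ≤ 1 := by rw [div_le_one (by linarith)]; linarith
    have h := one_add_mul_le_pow (a := -(1 / (H : ℝ))) (by linarith) t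
    have h4 : (t : ℝ) * (1 / H) ≤ 1 / 2 := by
      rw [mul_one_div, div_le_iff₀ (by linarith)]
      linarith
    rw [← sub_eq_add_neg] at h
    linarith
  obtain ⟨g, b, hgb⟩ := Fintype.exists_pair_of_one_lt_card (α := S) (by omega)
  have hτ : (96 * ε / H) ^ 2 ≤ 1 / 8 := by
    have h8 : 0 < √(8 : ℝ) := by positivity
    have h1 : 96 * ε / H ≤ 1 / √8 := by
      rw [div_le_iff₀ (by linarith)]
      rw [lt_div_iff₀ (by positivity)] at hε'
      rw [one_div, ← div_eq_inv_mul, le_div_iff₀ h8]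
      nlinarith
    calc (96 * ε / H) ^ 2 ≤ (1 / √8) ^ 2 := by gcongr
      _ = 1 / 8 := by rw [div_pow, Real.sq_sqrt (by norm_num)]; norm_num
  let F : HardFamily S :=
    { good := g, bad := b, good_ne_bad := hgb, L := H / 2, q := 1 / H, τ := 96 * ε / H
      q_nonneg := by positivity
      q_le_one := by rw [div_le_one (by linarith)]; linarith
      τ_nonneg := by positivity
      τ_sq_le := hτ
      two_lt_card := by omega }
  have hFL : F.L = H / 2 := rfl
  have hFq : F.q = 1 / H := rfl
  have hFτ : F.τ = 96 * ε / H := rfl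
  have hW := F.card_waiting_pos
  have hWS : (Fintype.card S : ℝ) ≤ 2 * F.waiting.card := by
    rw [F.card_waiting]
    linarith
  have hbudget : 256 * (n * (F.q * F.τ ^ 2)) ≤ (Fintype.card A : ℝ) * F.waiting.card := by
    have h1 : 256 * (n * (F.q * F.τ ^ 2)) = n * (2359296 * ε ^ 2 / H ^ 3) := by
      rw [hFq, hFτ]
      field_simp
      ring
    rw [h1]
    calc (n : ℝ) * (2359296 * ε ^ 2 / (H : ℝ) ^ 3)
      _ ≤ (1 / 4718592 * (H : ℝ) ^ 3 * (Fintype.card S : ℝ) * (Fintype.card A : ℝ) / ε ^ 2) *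
          (2359296 * ε ^ 2 / (H : ℝ) ^ 3) := by gcongr
      _ = (Fintype.card A : ℝ) * ((Fintype.card S : ℝ) / 2) := by
        field_simp
        ring
      _ ≤ (Fintype.card A : ℝ) * (F.waiting.card : ℝ) := by
        gcongr
        linarith
  obtain ⟨θ, hθ⟩ := F.exists_le_expect_miss (H := H) (by omega) (by omega) hA hbehav n hbudget
    (fun ω => out fun i => pathEpisode F.reward (ω i)) (fun ω => hout _)
  have hL : (0 : ℝ) < F.L := by exact_mod_cast (by omega : 0 < F.L)
  have hL3 : (H : ℝ) ≤ 3 * F.L := by exact_mod_cast (by omega : H ≤ 3 * F.L)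
  have hV : (H : ℝ) ≤ 2 * (H - F.L : ℕ) := by exact_mod_cast (by omega : H ≤ 2 * (H - F.L))
  refine ⟨F.mdp (some ∘ θ), fun t s a => Measure.dirac (F.reward t s a), ?_, ?_⟩
  · intro t s a
    have h0 := (F.mdp (some ∘ θ)).r_nonneg t s a
    have h1 := (F.mdp (some ∘ θ)).r_le_one t s a
    refine ⟨inferInstance, ?_, ?_⟩
    · rw [Measure.dirac_apply, Set.indicator_of_notMem]
      exact fun h => h ⟨h0, h1⟩
    · rw [integral_dirac]
      rfl
  set w := seqWeight (pathKernel (F.mdp (some ∘ θ)) F.reward behav) n with hw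
  set Z : (Fin n → Fin H → S × A) → ℝ := fun ω =>
    ∑ c ∈ (univ : Finset (Fin F.L)) ×ˢ F.waiting,
      (1 - out (fun i => pathEpisode F.reward (ω i)) c.1 c.2 (θ c)) with hZ
  have hw0 : ∀ ω, 0 ≤ w ω := seqWeight_nonneg (pathKernel_nonneg _ F.reward hbehav) n
  have hw1 : ∑ ω, w ω = 1 := sum_seqWeight (sum_pathKernel _ F.reward hbehav hH) n
  have hZle : ∀ ω, Z ω ≤ F.L * F.waiting.card := by
    intro ω
    have : Z ω ≤ ∑ c ∈ (univ : Finset (Fin F.L)) ×ˢ F.waiting, (1 : ℝ) :=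
      sum_le_sum fun c _ => sub_le_self _ ((hout _).1 _ _ _)
    simpa [card_product] using this
  let f : (Fin n → Fin H → S × A) → ℝ := fun ω =>
    if F.L * F.waiting.card / 8 ≤ Z ω then 1 else 0
  have hprob : 1 / 8 ≤ ∑ ω, w ω * f ω := by
    have h1 : ∑ ω, w ω * Z ω ≤
        ∑ ω, (w ω * f ω + w ω * (1 / 8)) * (F.L * F.waiting.card) := by
      refine sum_le_sum fun ω _ => ?_
      rw [← mul_add, mul_assoc]
      refine mul_le_mul_of_nonneg_left ?_ (hw0 ω)
      have := hZle ω
      have hLW : 0 < (F.L : ℝ) * F.waiting.card := by positivity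
      by_cases h : F.L * F.waiting.card / 8 ≤ Z ω
      · simp only [f, if_pos h]
        linarith
      · simp only [f, if_neg h]
        linarith [not_le.1 h]
    rw [← sum_mul, sum_add_distrib, ← sum_mul, hw1] at h1
    have h2 : (F.L * F.waiting.card : ℝ) * (1 / 4) ≤
        F.L * F.waiting.card * (∑ ω, w ω * f ω + 1 / 8) := by linarith
    linarith [le_of_mul_le_mul_left h2 (by positivity)]
  refine (ENNReal.ofReal_le_ofReal (show (1 : ℝ) / 12 ≤ ∑ ω, w ω * f ω by linarith)).trans ?_
  refine ofReal_sum_le_algLaw_dirac _ F.reward behav hbehav n _ f (fun ω => ?_) (fun ω => ?_)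
    (fun ω hω => ?_)
  · dsimp only [f]
    split_ifs <;> norm_num
  · dsimp only [f]
    split_ifs <;> norm_num
  · have hZω : F.L * F.waiting.card / 8 ≤ Z ω := by
      by_contra h
      exact hω (if_neg h)
    refine le_trans ?_ (F.le_regret θ (H := H) (by omega) hpow (hout _))
    calc ε ≤ ((H - F.L : ℕ) / H) * (F.L / H) * (6 * ε) := by
          have h1 : (1 : ℝ) / 2 ≤ (H - F.L : ℕ) / H := by
            rw [le_div_iff₀ (by linarith)]
            linarith
          have h2 : (1 : ℝ) / 3 ≤ F.L / H := by
            rw [le_div_iff₀ (by linarith)]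
            linarith
          calc ε = 1 / 2 * (1 / 3) * (6 * ε) := by ring
            _ ≤ _ := by gcongr
      _ = F.q * (H - F.L : ℕ) * F.τ / (2 * F.waiting.card) * (F.L * F.waiting.card / 8) := by
          rw [hFq, hFτ]
          field_simp
          ring
      _ ≤ _ := mul_le_mul_of_nonneg_left hZω (by
          have := F.q_nonneg
          have := F.τ_nonneg
          positivity)

end OPE
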